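/- Let k ≥ 0 and let y be a Zumkeller number with 2^k ≤ y < 2^{k+1}. Then Ulam[y] is eventually biperiodic with biperiod 2^{k+1}×2^{k+1}, with all aperiodicities confined to the block {(x,z) : x,z < 2^{k+1}}: for every (x,z) ∈ ℕ×ℕ with max(x,z) ≥ 2^{k+1}, the three statements (x,z) ∈ Ulam[y], (x+2^{k+1},z) ∈ Ulam[y], and (x,z+2^{k+1}) ∈ Ulam[y] are equivalent. Moreover, Ulam[y] is not biperiodic with biperiod P×P for any P ≥ 1. -/

import Mathlib

/-- Fuel-indexed Ulam predicate: a binary word (as a `List Bool`) of length 1 is Ulam,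
and a longer word is Ulam iff it is expressible *uniquely* as a concatenation of two
distinct (nonempty) Ulam words. The fuel strictly exceeds the lengths needed. -/
def ulamAux : ℕ → List Bool → Prop
  | 0, _ => False
  | n + 1, w =>
    if w.length = 1 then True
    else ∃! p : List Bool × List Bool,
      p.1 ≠ [] ∧ p.2 ≠ [] ∧ p.1 ≠ p.2 ∧ w = p.1 ++ p.2 ∧
        ulamAux n p.1 ∧ ulamAux n p.2

/-- A binary word is an Ulam word. -/
def IsUlam (w : List Bool) : Prop := ulamAux w.length w

/-- The word `0^x 1 0^y`. -/
def wordTwo (x y : ℕ) : List Bool :=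
  List.replicate x false ++ [true] ++ List.replicate y false

/-- The word `0^x 1 0^y 1 0^z`. -/
def wordThree (x y z : ℕ) : List Bool :=
  List.replicate x false ++ [true] ++ List.replicate y false ++ [true] ++
    List.replicate z false

/-- `UlamSet y` is the set of pairs `(x,z)` such that `0^x 1 0^y 1 0^z` is Ulam. -/
def UlamSet (y : ℕ) : Set (ℕ × ℕ) := {p | IsUlam (wordThree p.1 y p.2)}

/-- `culam y x z = min(2, N)` where `N` counts `0 ≤ a ≤ y` with both
`w(x,a)` and `w(y-a,z)` Ulam. -/
noncomputable def culam (y x z : ℕ) : ℕ :=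
  min 2 {a : ℕ | a ≤ y ∧ IsUlam (wordTwo x a) ∧ IsUlam (wordTwo (y - a) z)}.ncard

/-- A positive integer is Zumkeller if its binary representation has at most one `0`. -/
def IsZumkeller (y : ℕ) : Prop := 0 < y ∧ (Nat.bits y).count false ≤ 1

/-- The largest `e ≤ d - 1` with `x mod 2^(e+1) < 2^e` and `z mod 2^(e+1) < 2^e`
(and `0` if none exists). -/
def eIdx (d x z : ℕ) : ℕ :=
  Nat.findGreatest (fun e => x % 2 ^ (e + 1) < 2 ^ e ∧ z % 2 ^ (e + 1) < 2 ^ e) (d - 1)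

/-- The universal pattern `E1[d]` on `B_d`. -/
def E1 (d x z : ℕ) : ℕ :=
  if 2 ^ d - 1 ≤ x + z then 0
  else if x % 2 ^ eIdx d x z + z % 2 ^ eIdx d x z < 2 ^ eIdx d x z - 1 then 2 else 1

/-- The universal pattern `E2[d]` on `B_d` (constant `1`). -/
def E2 (_d _x _z : ℕ) : ℕ := 1

/-- The universal pattern `O1[d]` on `B_d`. -/
def O1 (d x z : ℕ) : ℕ :=
  if 2 ^ d - 2 ≤ x + z then 0
  else if (x + z) % 2 = 0 then (if x % 2 = 1 then 0 else 2)
  else if x % 2 ^ eIdx d x z + z % 2 ^ eIdx d x z < 2 ^ eIdx d x z - 1 then 2 else 1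

/-- The universal pattern `O2[d]` on `B_d` (independent of `d`). -/
def O2 (_d x z : ℕ) : ℕ :=
  if (x + z) % 2 = 0 then (if x % 2 = 1 then 0 else 2) else 1

open Finset

/-! ### Bitwise disjointness -/

/-- Two naturals have no common binary digit `1`. -/
def BitDisjoint (x a : ℕ) : Prop := x &&& a = 0

instance (x a : ℕ) : Decidable (BitDisjoint x a) := inferInstanceAs (Decidable (_ = _))

theorem bitDisjoint_comm {x a : ℕ} : BitDisjoint x a ↔ BitDisjoint a x := by
  simp only [BitDisjoint, Nat.land_comm]

@[simp] theorem bitDisjoint_zero_left (a : ℕ) : BitDisjoint 0 a := by simp [BitDisjoint]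

@[simp] theorem bitDisjoint_zero_right (a : ℕ) : BitDisjoint a 0 := by simp [BitDisjoint]

theorem bitDisjoint_iff_div_two (x a : ℕ) :
    BitDisjoint x a ↔ (x % 2 = 0 ∨ a % 2 = 0) ∧ BitDisjoint (x / 2) (a / 2) := by
  unfold BitDisjoint
  have h1 : (x &&& a) / 2 = x / 2 &&& a / 2 := Nat.and_div_two
  have h2 : (x &&& a) % 2 = 1 ↔ x % 2 = 1 ∧ a % 2 = 1 := Nat.and_mod_two_eq_one
  rw [← h1]
  omega

theorem bitDisjoint_even_right (x a : ℕ) :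
    BitDisjoint x (2 * a) ↔ BitDisjoint (x / 2) a := by
  rw [bitDisjoint_iff_div_two, show 2 * a / 2 = a by omega]
  simp

theorem bitDisjoint_odd_right (x a : ℕ) :
    BitDisjoint x (2 * a + 1) ↔ x % 2 = 0 ∧ BitDisjoint (x / 2) a := by
  rw [bitDisjoint_iff_div_two, show (2 * a + 1) / 2 = a by omega]
  simp

theorem bitDisjoint_even_left (x a : ℕ) :
    BitDisjoint (2 * x) a ↔ BitDisjoint x (a / 2) := by
  rw [bitDisjoint_comm, bitDisjoint_even_right, bitDisjoint_comm]

theorem bitDisjoint_odd_left (x a : ℕ) :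
    BitDisjoint (2 * x + 1) a ↔ a % 2 = 0 ∧ BitDisjoint x (a / 2) := by
  rw [bitDisjoint_comm, bitDisjoint_odd_right, bitDisjoint_comm]

/-- The relation `BitDisjoint` obeys Pascal's rule modulo two. -/
theorem bitDisjoint_succ_succ (x a : ℕ) :
    BitDisjoint (x + 1) (a + 1) ↔
      (BitDisjoint x (a + 1) ↔ ¬ BitDisjoint (x + 1) a) := by
  induction x using Nat.strong_induction_on generalizing a with
  | _ x ih =>
    obtain ⟨m, rfl | rfl⟩ := Nat.even_or_odd' x <;> obtain ⟨n, rfl | rfl⟩ := Nat.even_or_odd' a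
    · rw [bitDisjoint_odd_left, bitDisjoint_even_left, bitDisjoint_odd_left]
      have h1 : (2 * n + 1) / 2 = n := by omega
      have h2 : 2 * n / 2 = n := by omega
      rw [h1, h2]
      simp
    · rw [bitDisjoint_odd_left, bitDisjoint_even_left, bitDisjoint_odd_left]
      have h3 : (2 * n + 1 + 1) % 2 = 0 := by omega
      simp [h3]
    · rw [show 2 * m + 1 + 1 = 2 * (m + 1) by ring, bitDisjoint_even_left, bitDisjoint_odd_left,
        bitDisjoint_even_left]
      have h1 : (2 * n + 1) / 2 = n := by omega
      have h2 : 2 * n / 2 = n := by omega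
      simp [h1, h2]
    · rw [show 2 * m + 1 + 1 = 2 * (m + 1) by ring, bitDisjoint_even_left, bitDisjoint_odd_left,
        bitDisjoint_even_left]
      have h3 : (2 * n + 1 + 1) % 2 = 0 := by omega
      have h1 : (2 * n + 1) / 2 = n := by omega
      have h2 : (2 * n + 1 + 1) / 2 = n + 1 := by omega
      simp only [h1, h2, h3, true_and]
      exact ih m (by omega) n

theorem bitDisjoint_mod_two_pow {k a : ℕ} (x : ℕ) (ha : a < 2 ^ k) :
    BitDisjoint (x % 2 ^ k) a ↔ BitDisjoint x a := by
  unfold BitDisjoint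
  have : x % 2 ^ k &&& a = x &&& a := by
    apply Nat.eq_of_testBit_eq
    intro i
    simp only [Nat.testBit_land, Nat.testBit_mod_two_pow]
    by_cases hi : i < k
    · simp [hi]
    · have : a.testBit i = false :=
        Nat.testBit_lt_two_pow (ha.trans_le (Nat.pow_le_pow_right (by norm_num) (by omega)))
      simp [this]
  rw [this]

/-! ### Counting splittings -/

/-- The number of `a ≤ y` with `a` disjoint from `x` and `y - a` disjoint from `z`. -/
def splitCount (y x z : ℕ) : ℕ :=
  ∑ a ∈ range (y + 1), if BitDisjoint x a ∧ BitDisjoint (y - a) z then 1 else 0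

/-- As `splitCount`, but omitting a splitting into two equal words. -/
def properSplitCount (y x z : ℕ) : ℕ :=
  ∑ a ∈ range (y + 1),
    if BitDisjoint x a ∧ BitDisjoint (y - a) z ∧ ¬ (x = y - a ∧ a = z) then 1 else 0

theorem splitCount_pos {y x z a : ℕ} (ha : a ≤ y) (h1 : BitDisjoint x a)
    (h2 : BitDisjoint (y - a) z) : 0 < splitCount y x z := by
  unfold splitCount
  rw [sum_boole, Nat.cast_id, card_pos]
  exact ⟨a, by simp [h1, h2]; omega⟩

theorem properSplitCount_symm (y x z : ℕ) :
    properSplitCount y x z = properSplitCount y z x := by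
  unfold properSplitCount
  rw [← sum_range_reflect]
  refine sum_congr rfl fun a ha => ?_
  have ha : a ≤ y := by simpa [Nat.lt_succ_iff] using ha
  have e1 : y + 1 - 1 - a = y - a := by omega
  have e2 : y - (y - a) = a := by omega
  rw [e1, e2]
  refine if_congr ?_ rfl rfl
  rw [bitDisjoint_comm (x := x), bitDisjoint_comm (x := a)]
  have : (x = a ∧ y - a = z) ↔ (z = y - a ∧ a = x) := by omega
  rw [this]
  tauto

theorem properSplitCount_of_add_ne {y x z : ℕ} (h : x + z ≠ y) :
    properSplitCount y x z = splitCount y x z := by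
  unfold properSplitCount splitCount
  refine sum_congr rfl fun a ha => if_congr ?_ rfl rfl
  have ha : a ≤ y := by simpa [Nat.lt_succ_iff] using ha
  have : ¬ (x = y - a ∧ a = z) := by omega
  simp [this]

theorem properSplitCount_self_zero (y : ℕ) :
    properSplitCount y y 0 + 1 = splitCount y y 0 := by
  unfold properSplitCount splitCount
  rw [sum_range_succ' _ y, sum_range_succ' _ y]
  have : ∀ a ∈ range y, (if BitDisjoint y (a + 1) ∧ BitDisjoint (y - (a + 1)) 0 ∧
      ¬ (y = y - (a + 1) ∧ a + 1 = 0) then 1 else 0) =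
      (if BitDisjoint y (a + 1) ∧ BitDisjoint (y - (a + 1)) 0 then 1 else 0) := by
    intro a _
    simp
  rw [sum_congr rfl this]
  simp

theorem splitCount_mod_two_pow {k y : ℕ} (hy : y < 2 ^ k) (x z : ℕ) :
    splitCount y (x % 2 ^ k) (z % 2 ^ k) = splitCount y x z := by
  unfold splitCount
  refine sum_congr rfl fun a ha => if_congr ?_ rfl rfl
  have ha : a ≤ y := by simpa [Nat.lt_succ_iff] using ha
  rw [bitDisjoint_mod_two_pow x (by omega), bitDisjoint_comm (a := z % 2 ^ k),
    bitDisjoint_mod_two_pow z (by omega), bitDisjoint_comm (a := z)]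

theorem sum_range_two_mul {M : Type*} [AddCommMonoid M] (f : ℕ → M) (n : ℕ) :
    ∑ a ∈ range (2 * n), f a = ∑ a ∈ range n, (f (2 * a) + f (2 * a + 1)) := by
  induction n with
  | zero => simp
  | succ n ih => rw [show 2 * (n + 1) = 2 * n + 1 + 1 by ring, sum_range_succ, sum_range_succ, ih,
      sum_range_succ, add_assoc]

@[simp] theorem splitCount_zero (x z : ℕ) : splitCount 0 x z = 1 := by
  rw [splitCount, sum_range_one]
  simp

theorem splitCount_odd (y x z : ℕ) :
    splitCount (2 * y + 1) x z =
      ((if x % 2 = 0 then 1 else 0) + (if z % 2 = 0 then 1 else 0)) *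
        splitCount y (x / 2) (z / 2) := by
  unfold splitCount
  rw [show 2 * y + 1 + 1 = 2 * (y + 1) by ring, sum_range_two_mul, mul_sum]
  refine sum_congr rfl fun a ha => ?_
  have ha : a ≤ y := by simpa [Nat.lt_succ_iff] using ha
  rw [show 2 * y + 1 - 2 * a = 2 * (y - a) + 1 by omega,
    show 2 * y + 1 - (2 * a + 1) = 2 * (y - a) by omega]
  simp only [bitDisjoint_even_right, bitDisjoint_odd_right, bitDisjoint_odd_left,
    bitDisjoint_even_left]
  by_cases h1 : x % 2 = 0 <;> by_cases h2 : z % 2 = 0 <;>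
  by_cases h3 : BitDisjoint (x / 2) a <;> by_cases h4 : BitDisjoint (y - a) (z / 2) <;>
  simp [h1, h2, h3, h4]

theorem splitCount_even (y x z : ℕ) :
    splitCount (2 * (y + 1)) x z =
      splitCount (y + 1) (x / 2) (z / 2) +
        if x % 2 = 0 ∧ z % 2 = 0 then splitCount y (x / 2) (z / 2) else 0 := by
  unfold splitCount
  rw [sum_range_succ, sum_range_two_mul, sum_add_distrib, sum_range_succ _ (y + 1)]
  have e1 : ∀ a ∈ range (y + 1),
      (if BitDisjoint x (2 * a) ∧ BitDisjoint (2 * (y + 1) - 2 * a) z then 1 else 0) =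
      if BitDisjoint (x / 2) a ∧ BitDisjoint (y + 1 - a) (z / 2) then 1 else 0 := by
    intro a _
    simp only [← Nat.mul_sub, bitDisjoint_even_right, bitDisjoint_even_left]
  have e2 : ∀ a ∈ range (y + 1),
      (if BitDisjoint x (2 * a + 1) ∧ BitDisjoint (2 * (y + 1) - (2 * a + 1)) z then 1 else 0) =
      if x % 2 = 0 ∧ z % 2 = 0 then
        (if BitDisjoint (x / 2) a ∧ BitDisjoint (y - a) (z / 2) then 1 else 0) else 0 := by
    intro a ha
    have ha : a ≤ y := by simpa [Nat.lt_succ_iff] using ha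
    rw [show 2 * (y + 1) - (2 * a + 1) = 2 * (y - a) + 1 by omega]
    simp only [bitDisjoint_odd_right, bitDisjoint_odd_left]
    by_cases h1 : x % 2 = 0 <;> by_cases h2 : z % 2 = 0 <;> simp [h1, h2]
  rw [sum_congr rfl e1, sum_congr rfl e2]
  simp only [bitDisjoint_even_right, Nat.sub_self, bitDisjoint_zero_left, and_true]
  split_ifs <;> first
  | ring1
  | rw [sum_const_zero]; ring1

theorem splitCount_of_two_pow_le_add {k x z y : ℕ} (hy : y + 1 = 2 ^ k) (h : 2 ^ k ≤ x + z)
    (hx : x < 2 ^ k) (hz : z < 2 ^ k) : splitCount y x z = 0 := by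
  induction k generalizing x z y with
  | zero => omega
  | succ k ih =>
    have e : 2 ^ (k + 1) = 2 * 2 ^ k := pow_succ' 2 k
    obtain ⟨y, rfl⟩ : ∃ m, y = 2 * m + 1 := ⟨y / 2, by omega⟩
    rw [splitCount_odd]
    by_cases h' : x % 2 = 1 ∧ z % 2 = 1
    · simp [h'.1, h'.2]
    · rw [ih (by omega) (by omega) (by omega) (by omega), mul_zero]

theorem splitCount_odd_eq_one_iff (y x z : ℕ) :
    splitCount (2 * y + 1) x z = 1 ↔
      (x + z) % 2 = 1 ∧ splitCount y (x / 2) (z / 2) = 1 := by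
  rw [splitCount_odd]
  by_cases h1 : x % 2 = 0 <;> by_cases h2 : z % 2 = 0 <;> simp only [h1, h2, if_true, if_false] <;>
    omega

theorem splitCount_full_eq_one_iff {k x z y : ℕ} (hy : y + 1 = 2 ^ k)
    (hx : x < 2 ^ k) (hz : z < 2 ^ k) : splitCount y x z = 1 ↔ x + z = y := by
  induction k generalizing x z y with
  | zero =>
    obtain rfl : y = 0 := by simpa using hy
    obtain rfl : x = 0 := by simpa using hx
    obtain rfl : z = 0 := by simpa using hz
    simp
  | succ k ih =>
    have e : 2 ^ (k + 1) = 2 * 2 ^ k := pow_succ' 2 k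
    obtain ⟨y, rfl⟩ : ∃ m, y = 2 * m + 1 := ⟨y / 2, by omega⟩
    rw [splitCount_odd_eq_one_iff, ih (by omega) (by omega) (by omega)]
    omega

theorem splitCount_pred_full_eq_one_iff {k x z y : ℕ} (hy : y + 2 = 2 ^ (k + 2))
    (hx : x < 2 ^ (k + 2)) (hz : z < 2 ^ (k + 2)) :
    splitCount y x z = 1 ↔ x + z = y + 1 ∨ x + z = y + 2 := by
  induction k generalizing x z y with
  | zero =>
    obtain rfl : y = 2 := by simpa using hy
    simp at hx hz
    interval_cases x <;> interval_cases z <;> decide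
  | succ k ih =>
    have e : 2 ^ (k + 1 + 2) = 2 * 2 ^ (k + 2) := by ring
    have e' : 2 ^ (k + 2) = 4 * 2 ^ k := by ring
    have : 0 < 2 ^ k := by positivity
    obtain ⟨y, rfl⟩ : ∃ m, y = 2 * (m + 1) := ⟨y / 2 - 1, by omega⟩
    rw [splitCount_even]
    have h1 := ih (x := x / 2) (z := z / 2) (y := y) (by omega) (by omega) (by omega)
    have h2 := splitCount_full_eq_one_iff (x := x / 2) (z := z / 2) (y := y + 1) (k := k + 2)
      (by omega) (by omega) (by omega)
    have h3 := splitCount_of_two_pow_le_add (x := x / 2) (z := z / 2) (y := y + 1) (k := k + 2)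
      (by omega)
    split_ifs with h
    · constructor
      · omega
      · rintro (h' | h')
        · omega
        · rw [h3 (by omega) (by omega) (by omega)]
          omega
    · omega

theorem splitCount_zumkeller_eq_one_iff {k j x z y : ℕ} (hj : j < k)
    (hy : y + 2 ^ j + 1 = 2 ^ (k + 1)) (hx : x < 2 ^ (k + 1)) (hz : z < 2 ^ (k + 1)) :
    splitCount y x z = 1 ↔ x + z = y + 2 ^ j ∨ x + z = y + 2 ^ j + 2 ^ j := by
  induction j generalizing x z y k with
  | zero =>
    obtain ⟨k, rfl⟩ : ∃ m, k = m + 1 := ⟨k - 1, by omega⟩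
    exact splitCount_pred_full_eq_one_iff hy hx hz
  | succ j ih =>
    obtain ⟨k, rfl⟩ : ∃ m, k = m + 1 := ⟨k - 1, by omega⟩
    have e : 2 ^ (k + 1 + 1) = 2 * 2 ^ (k + 1) := pow_succ' 2 _
    have e' : 2 ^ (j + 1) = 2 * 2 ^ j := pow_succ' 2 _
    obtain ⟨y, rfl⟩ : ∃ m, y = 2 * m + 1 := ⟨y / 2, by omega⟩
    rw [splitCount_odd_eq_one_iff,
      ih (k := k) (by omega) (by omega) (by omega) (by omega)]
    omega

theorem splitCount_zumkeller_self_zero {k j y : ℕ} (hj : j < k)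
    (hy : y + 2 ^ j + 1 = 2 ^ (k + 1)) : splitCount y y 0 = 2 := by
  induction j generalizing y k with
  | zero =>
    obtain ⟨k, rfl⟩ : ∃ m, k = m + 1 := ⟨k - 1, by omega⟩
    have e : 2 ^ (k + 1 + 1) = 2 * 2 ^ (k + 1) := pow_succ' 2 _
    have : 0 < 2 ^ k := by positivity
    have e2 : 2 ^ (k + 1) = 2 * 2 ^ k := pow_succ' 2 _
    obtain ⟨y, rfl⟩ : ∃ m, y = 2 * (m + 1) := ⟨y / 2 - 1, by omega⟩
    rw [splitCount_even, show 2 * (y + 1) / 2 = y + 1 by omega,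
      (splitCount_full_eq_one_iff (k := k + 1) (by omega) (by omega) (by omega)).2 (by omega)]
    obtain rfl | hk := Nat.eq_zero_or_pos k
    · obtain rfl : y = 0 := by omega
      simp
    · obtain ⟨k, rfl⟩ : ∃ m, k = m + 1 := ⟨k - 1, by omega⟩
      have e3 : 2 ^ (k + 2) = 2 * 2 ^ (k + 1) := pow_succ' 2 _
      rw [Nat.zero_div, (splitCount_pred_full_eq_one_iff (k := k) (by omega) (by omega)
        (by omega)).2 (by omega)]
      simp
  | succ j ih =>
    obtain ⟨k, rfl⟩ : ∃ m, k = m + 1 := ⟨k - 1, by omega⟩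
    have e : 2 ^ (k + 1 + 1) = 2 * 2 ^ (k + 1) := pow_succ' 2 _
    have e' : 2 ^ (j + 1) = 2 * 2 ^ j := pow_succ' 2 _
    obtain ⟨y, rfl⟩ : ∃ m, y = 2 * m + 1 := ⟨y / 2, by omega⟩
    rw [splitCount_odd, show (2 * y + 1) / 2 = y by omega, Nat.zero_div,
      ih (k := k) (by omega) (by omega)]
    simp

theorem exists_gap_of_isZumkeller {k y : ℕ} (h1 : 2 ^ k ≤ y) (h2 : y < 2 ^ (k + 1))
    (hz : (Nat.bits y).count false ≤ 1) :
    y + 1 = 2 ^ (k + 1) ∨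
      ∃ j < k, y + 2 ^ j + 1 = 2 ^ (k + 1) ∧ (Nat.bits y).count false = 1 := by
  induction k generalizing y with
  | zero => left; omega
  | succ k ih =>
    have e : 2 ^ (k + 1 + 1) = 2 * 2 ^ (k + 1) := pow_succ' 2 _
    have e' : 2 ^ (k + 1) = 2 * 2 ^ k := pow_succ' 2 _
    have : 0 < 2 ^ k := by positivity
    obtain ⟨m, rfl | rfl⟩ := Nat.even_or_odd' y
    · rw [Nat.bit0_bits _ (by omega), List.count_cons_self] at hz ⊢
      rcases ih (y := m) (by omega) (by omega) (by omega) with h | ⟨j, _, _, h⟩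
      · exact Or.inr ⟨0, by omega, by omega, by omega⟩
      · omega
    · rw [Nat.bit1_bits, List.count_cons_of_ne (by decide)] at hz ⊢
      rcases ih (y := m) (by omega) (by omega) hz with h | ⟨j, hj, h, hcount⟩
      · left; omega
      · exact Or.inr ⟨j + 1, by omega, by rw [pow_succ' 2 j]; omega, hcount⟩

/-! ### Splittings of Ulam words -/

theorem not_ulamAux_nil (n : ℕ) : ¬ ulamAux n [] := by
  cases n with
  | zero => exact id
  | succ n =>
    rw [ulamAux, if_neg (by simp)]
    rintro ⟨p, ⟨h1, _, _, h2, _⟩, _⟩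
    exact h1 (List.append_eq_nil_iff.1 h2.symm).1

theorem ulamAux_congr {n m : ℕ} {w : List Bool} (hn : w.length ≤ n) (hm : w.length ≤ m) :
    ulamAux n w ↔ ulamAux m w := by
  induction n generalizing m w with
  | zero =>
    obtain rfl : w = [] := List.length_eq_zero_iff.1 (by omega)
    simp [not_ulamAux_nil]
  | succ n ih =>
    cases m with
    | zero =>
      obtain rfl : w = [] := List.length_eq_zero_iff.1 (by omega)
      simp [not_ulamAux_nil]
    | succ m =>
      rw [ulamAux, ulamAux]
      split_ifs with h
      · rfl
      · refine existsUnique_congr fun p => ?_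
        refine and_congr_right fun h1 => and_congr_right fun h2 => and_congr_right fun _ =>
          and_congr_right fun h3 => ?_
        have e : w.length = p.1.length + p.2.length := by rw [h3, List.length_append]
        have l1 := List.length_pos_iff.2 h1
        have l2 := List.length_pos_iff.2 h2
        exact and_congr (ih (by omega) (by omega)) (ih (by omega) (by omega))

theorem isUlam_iff_existsUnique {w : List Bool} (h : 2 ≤ w.length) :
    IsUlam w ↔ ∃! p : List Bool × List Bool,
      p.1 ≠ [] ∧ p.2 ≠ [] ∧ p.1 ≠ p.2 ∧ w = p.1 ++ p.2 ∧ IsUlam p.1 ∧ IsUlam p.2 := by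
  unfold IsUlam
  obtain ⟨n, hn⟩ : ∃ n, w.length = n + 1 := ⟨w.length - 1, by omega⟩
  rw [hn, ulamAux, if_neg (by omega)]
  refine existsUnique_congr fun p => ?_
  refine and_congr_right fun h1 => and_congr_right fun h2 => and_congr_right fun _ =>
    and_congr_right fun h3 => ?_
  have e : w.length = p.1.length + p.2.length := by rw [h3, List.length_append]
  have l1 := List.length_pos_iff.2 h1
  have l2 := List.length_pos_iff.2 h2
  exact and_congr (ulamAux_congr (by omega) (by omega)) (ulamAux_congr (by omega) (by omega))

theorem isUlam_of_length_eq_one {w : List Bool} (h : w.length = 1) : IsUlam w := by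
  rw [IsUlam, h, ulamAux, if_pos h]
  trivial

open Classical in
/-- `1` if cutting `w` after `i` letters gives two distinct Ulam words, and `0` otherwise. -/
noncomputable def cutIndicator (w : List Bool) (i : ℕ) : ℕ :=
  if w.take i ≠ w.drop i ∧ IsUlam (w.take i) ∧ IsUlam (w.drop i) then 1 else 0

open Classical in
theorem cutIndicator_eq {w u v : List Bool} {i : ℕ} (h : w = u ++ v) (hi : i = u.length) :
    cutIndicator w i = if u ≠ v ∧ IsUlam u ∧ IsUlam v then 1 else 0 := by
  subst h hi
  simp [cutIndicator]

theorem isUlam_iff_sum_cutIndicator {w : List Bool} (h : 2 ≤ w.length) :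
    IsUlam w ↔ ∑ i ∈ Ico 1 w.length, cutIndicator w i = 1 := by
  classical
  rw [isUlam_iff_existsUnique h]
  simp only [cutIndicator]
  rw [sum_boole, Nat.cast_id, card_eq_one]
  constructor
  · rintro ⟨⟨u, v⟩, ⟨h1, h2, h3, h4, h5, h6⟩, huniq⟩
    dsimp only at h1 h2 h3 h4 h5 h6
    have l1 := List.length_pos_iff.2 h1
    have l2 := List.length_pos_iff.2 h2
    have e : w.length = u.length + v.length := by rw [h4, List.length_append]
    refine ⟨u.length, eq_singleton_iff_unique_mem.2 ⟨?_, fun i hi => ?_⟩⟩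
    · rw [mem_filter, mem_Ico, h4, List.take_left, List.drop_left, ← h4]
      exact ⟨by omega, h3, h5, h6⟩
    · rw [mem_filter, mem_Ico] at hi
      have := huniq (w.take i, w.drop i) ⟨List.length_pos_iff.1 (by simp; omega),
        List.length_pos_iff.1 (by simp; omega), hi.2.1, (List.take_append_drop i w).symm, hi.2.2⟩
      have := congrArg (fun p => p.1.length) this
      simp only [List.length_take] at this
      omega
  · rintro ⟨i, hi⟩
    obtain ⟨hmem, huniq⟩ := eq_singleton_iff_unique_mem.1 hi
    rw [mem_filter, mem_Ico] at hmem
    refine ⟨(w.take i, w.drop i), ⟨List.length_pos_iff.1 (by simp; omega),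
      List.length_pos_iff.1 (by simp; omega), hmem.2.1, (List.take_append_drop i w).symm,
      hmem.2.2⟩, ?_⟩
    rintro ⟨u, v⟩ ⟨h1, h2, h3, h4, h5⟩
    dsimp only at h1 h2 h3 h4 h5
    have l1 := List.length_pos_iff.2 h1
    have l2 := List.length_pos_iff.2 h2
    have e : w.length = u.length + v.length := by rw [h4, List.length_append]
    have : u.length = i := huniq _ (by
      rw [mem_filter, mem_Ico, h4, List.take_left, List.drop_left, ← h4]
      exact ⟨by omega, h3, h5⟩)
    rw [← this, h4, List.take_left, List.drop_left]

theorem isUlam_replicate_false {n : ℕ} : IsUlam (List.replicate n false) ↔ n = 1 := by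
  constructor
  · induction n using Nat.strong_induction_on with
    | _ n ih =>
      intro h
      by_contra hn
      obtain rfl | hn : n = 0 ∨ 2 ≤ n := by omega
      · exact not_ulamAux_nil 0 h
      · rw [isUlam_iff_sum_cutIndicator (by simpa using hn), List.length_replicate] at h
        rw [sum_eq_zero] at h
        · omega
        · intro i hi
          rw [mem_Ico] at hi
          rw [cutIndicator_eq (u := List.replicate i false) (v := List.replicate (n - i) false)
            (by rw [← List.replicate_add]; congr 1; omega) (by simp), if_neg]
          rintro ⟨h1, h2, h3⟩
          have h2 := ih i (by omega) h2
          have h3 := ih (n - i) (by omega) h3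
          rw [h2] at h1 h3
          rw [h3] at h1
          exact h1 rfl
  · rintro rfl
    exact isUlam_of_length_eq_one rfl

theorem replicate_false_ne {n : ℕ} {l : List Bool} (h : true ∈ l) :
    List.replicate n false ≠ l := by
  rintro rfl
  simp at h

open Classical in
theorem sum_cutIndicator_left (x : ℕ) {r : List Bool} (hr : true ∈ r) :
    ∑ i ∈ range x, cutIndicator (List.replicate x false ++ r) (1 + i) =
      if 0 < x ∧ IsUlam (List.replicate (x - 1) false ++ r) then 1 else 0 := by
  have key : ∀ i < x, cutIndicator (List.replicate x false ++ r) (1 + i) =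
      if i = 0 ∧ IsUlam (List.replicate (x - 1) false ++ r) then 1 else 0 := by
    intro i hi
    rw [cutIndicator_eq (u := List.replicate (1 + i) false)
      (v := List.replicate (x - 1 - i) false ++ r)
      (by rw [← List.append_assoc, ← List.replicate_add]; congr 2; omega) (by simp)]
    refine if_congr ?_ rfl rfl
    rw [isUlam_replicate_false]
    have : List.replicate (1 + i) false ≠ List.replicate (x - 1 - i) false ++ r :=
      replicate_false_ne (by simp [hr])
    constructor
    · rintro ⟨_, h1, h2⟩
      obtain rfl : i = 0 := by omega
      exact ⟨rfl, h2⟩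
    · rintro ⟨rfl, h⟩
      exact ⟨this, rfl, h⟩
  obtain rfl | hx := Nat.eq_zero_or_pos x
  · simp
  · rw [sum_eq_single 0, key 0 hx]
    · simp [hx]
    · intro i hi h0
      rw [key i (mem_range.1 hi), if_neg (by tauto)]
    · intro h
      simp at h
      omega

open Classical in
theorem sum_cutIndicator_right (z : ℕ) {l : List Bool} (hl : true ∈ l) :
    ∑ i ∈ range z, cutIndicator (l ++ List.replicate z false) (l.length + i) =
      if 0 < z ∧ IsUlam (l ++ List.replicate (z - 1) false) then 1 else 0 := by
  have key : ∀ i < z, cutIndicator (l ++ List.replicate z false) (l.length + i) =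
      if i = z - 1 ∧ IsUlam (l ++ List.replicate (z - 1) false) then 1 else 0 := by
    intro i hi
    rw [cutIndicator_eq (u := l ++ List.replicate i false)
      (v := List.replicate (z - i) false)
      (by rw [List.append_assoc, ← List.replicate_add]; congr 2; omega) (by simp)]
    refine if_congr ?_ rfl rfl
    rw [isUlam_replicate_false]
    have : l ++ List.replicate i false ≠ List.replicate (z - i) false :=
      (replicate_false_ne (by simp [hl])).symm
    constructor
    · rintro ⟨_, h1, h2⟩
      obtain rfl : i = z - 1 := by omega
      exact ⟨rfl, h1⟩
    · rintro ⟨rfl, h⟩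
      exact ⟨this, h, by omega⟩
  obtain rfl | hz := Nat.eq_zero_or_pos z
  · simp
  · rw [sum_eq_single (z - 1), key (z - 1) (by omega)]
    · simp [hz]
    · intro i hi h0
      rw [key i (mem_range.1 hi), if_neg (by tauto)]
    · intro h
      simp at h
      omega

theorem length_wordTwo (x y : ℕ) : (wordTwo x y).length = x + 1 + y := by
  simp [wordTwo]
  omega

theorem length_wordThree (x y z : ℕ) : (wordThree x y z).length = x + 1 + (y + 1) + z := by
  simp [wordThree]
  omega

theorem wordTwo_inj {x y x' y' : ℕ} : wordTwo x y = wordTwo x' y' ↔ x = x' ∧ y = y' := by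
  constructor
  · intro h
    have h1 := congrArg (List.idxOf true) h
    have h2 := congrArg List.length h
    simp [wordTwo, List.idxOf_append] at h1
    rw [length_wordTwo, length_wordTwo] at h2
    omega
  · rintro ⟨rfl, rfl⟩
    rfl

open Classical in
theorem isUlam_wordTwo_iff {x y : ℕ} (h : 0 < x + y) :
    IsUlam (wordTwo x y) ↔
      (if 0 < x ∧ IsUlam (wordTwo (x - 1) y) then 1 else 0) +
        (if 0 < y ∧ IsUlam (wordTwo x (y - 1)) then 1 else 0) = 1 := by
  rw [isUlam_iff_sum_cutIndicator (by rw [length_wordTwo]; omega), length_wordTwo,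
    ← sum_Ico_consecutive _ (show 1 ≤ x + 1 by omega) (show x + 1 ≤ x + 1 + y by omega),
    sum_Ico_eq_sum_range, sum_Ico_eq_sum_range, Nat.add_sub_cancel, Nat.add_sub_cancel_left]
  have h1 := sum_cutIndicator_left x (r := [true] ++ List.replicate y false) (by simp)
  have h2 := sum_cutIndicator_right y (l := List.replicate x false ++ [true]) (by simp)
  rw [← List.append_assoc, ← List.append_assoc] at h1
  rw [List.length_append, List.length_replicate, List.length_singleton] at h2
  unfold wordTwo
  rw [h1, h2]

theorem isUlam_wordTwo {x y : ℕ} : IsUlam (wordTwo x y) ↔ BitDisjoint x y := by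
  induction h : x + y generalizing x y with
  | zero =>
    obtain ⟨rfl, rfl⟩ : x = 0 ∧ y = 0 := by omega
    simpa using isUlam_of_length_eq_one rfl
  | succ n ih =>
    rw [isUlam_wordTwo_iff (by omega)]
    cases x with
    | zero =>
      simp [ih (x := 0) (y := y - 1) (by omega)]
      omega
    | succ x =>
      cases y with
      | zero => simp [ih (x := x) (y := 0) (by omega)]
      | succ y =>
        rw [bitDisjoint_succ_succ]
        simp only [Nat.add_sub_cancel, ih (x := x) (y := y + 1) (by omega),
          ih (x := x + 1) (y := y) (by omega), Nat.succ_pos, true_and]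
        by_cases h1 : BitDisjoint x (y + 1) <;> by_cases h2 : BitDisjoint (x + 1) y <;>
          simp [h1, h2]

open Classical in
theorem isUlam_wordThree_iff {x y z : ℕ} :
    IsUlam (wordThree x y z) ↔
      (if 0 < x ∧ IsUlam (wordThree (x - 1) y z) then 1 else 0) +
        (if 0 < z ∧ IsUlam (wordThree x y (z - 1)) then 1 else 0) +
        properSplitCount y x z = 1 := by
  rw [isUlam_iff_sum_cutIndicator (by rw [length_wordThree]; omega), length_wordThree,
    ← sum_Ico_consecutive _ (show 1 ≤ x + 1 by omega)
      (show x + 1 ≤ x + 1 + (y + 1) + z by omega),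
    ← sum_Ico_consecutive _ (show x + 1 ≤ x + 1 + (y + 1) by omega)
      (show x + 1 + (y + 1) ≤ x + 1 + (y + 1) + z by omega),
    sum_Ico_eq_sum_range, sum_Ico_eq_sum_range, sum_Ico_eq_sum_range, Nat.add_sub_cancel,
    Nat.add_sub_cancel_left, Nat.add_sub_cancel_left]
  have h1 := sum_cutIndicator_left x
    (r := [true] ++ List.replicate y false ++ [true] ++ List.replicate z false) (by simp)
  have h2 := sum_cutIndicator_right z
    (l := List.replicate x false ++ [true] ++ List.replicate y false ++ [true]) (by simp)
  have h3 : ∑ a ∈ range (y + 1), cutIndicator (wordThree x y z) (x + 1 + a) =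
      properSplitCount y x z := by
    refine sum_congr rfl fun a ha => ?_
    have ha : a ≤ y := by simpa [Nat.lt_succ_iff] using ha
    rw [cutIndicator_eq (u := wordTwo x a) (v := wordTwo (y - a) z) _ ?_]
    · refine if_congr ?_ rfl rfl
      rw [isUlam_wordTwo, isUlam_wordTwo, Ne, wordTwo_inj]
      tauto
    · have : List.replicate y false = List.replicate a false ++ List.replicate (y - a) false := by
        rw [← List.replicate_add, Nat.add_sub_cancel' ha]
      simp only [wordThree, wordTwo, this, List.append_assoc]
    · exact (length_wordTwo x a).symm
  simp only [← List.append_assoc] at h1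
  simp only [List.length_append, List.length_replicate, List.length_singleton] at h2
  rw [h3]
  unfold wordThree
  rw [h1, ← h2, ← add_assoc (x + 1) y 1]
  ring_nf

theorem isUlam_wordThree_symm (x y z : ℕ) :
    IsUlam (wordThree x y z) ↔ IsUlam (wordThree z y x) := by
  induction h : x + z generalizing x z with
  | zero =>
    obtain ⟨rfl, rfl⟩ : x = 0 ∧ z = 0 := by omega
    rfl
  | succ n ih =>
    rw [isUlam_wordThree_iff (x := x) (z := z), isUlam_wordThree_iff (x := z) (z := x),
      properSplitCount_symm y x z]
    have h1 : (0 < x ∧ IsUlam (wordThree (x - 1) y z)) ↔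
        (0 < x ∧ IsUlam (wordThree z y (x - 1))) :=
      and_congr_right fun hx => ih (x - 1) z (by omega)
    have h2 : (0 < z ∧ IsUlam (wordThree x y (z - 1))) ↔
        (0 < z ∧ IsUlam (wordThree (z - 1) y x)) :=
      and_congr_right fun hx => ih x (z - 1) (by omega)
    classical
    rw [if_congr h1 rfl rfl, if_congr h2 rfl rfl, add_comm (ite _ _ _) (ite _ _ _)]

theorem not_isUlam_wordThree_of_two_le {x y z : ℕ} (h : 2 ≤ properSplitCount y x z) :
    ¬ IsUlam (wordThree x y z) := by
  rw [isUlam_wordThree_iff]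
  omega

theorem not_isUlam_wordThree_diag {x y : ℕ} (h : properSplitCount y x x ≠ 1) :
    ¬ IsUlam (wordThree x y x) := by
  rw [isUlam_wordThree_iff, isUlam_wordThree_symm (x - 1) y x]
  split_ifs <;> omega

theorem pred_mod_of_mod_ne_zero {x n : ℕ} (h : x % n ≠ 0) : (x - 1) % n = x % n - 1 := by
  obtain rfl | hn := Nat.eq_zero_or_pos n
  · simp
  have h1 := Nat.div_add_mod x n
  have h2 := Nat.mod_lt x hn
  rw [show x - 1 = n * (x / n) + (x % n - 1) by omega, Nat.mul_add_mod,
    Nat.mod_eq_of_lt (by omega)]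

theorem le_pred_of_mod_ne_zero {x n : ℕ} (h : x % n ≠ 0) (hx : n ≤ x) : n ≤ x - 1 := by
  have : x ≠ n := by
    rintro rfl
    simp at h
  omega

theorem pred_mod_of_mod_eq_zero {x n : ℕ} (hn : 0 < n) (hx : 0 < x) (h : x % n = 0) :
    (x - 1) % n = n - 1 := by
  obtain ⟨m, rfl⟩ := Nat.dvd_of_mod_eq_zero h
  obtain ⟨m, rfl⟩ : ∃ l, m = l + 1 := ⟨m - 1, by
    have := Nat.pos_of_mul_pos_left hx
    omega⟩
  rw [show n * (m + 1) - 1 = n * m + (n - 1) by rw [mul_add]; omega, Nat.mul_add_mod,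
    Nat.mod_eq_of_lt (by omega)]

/-- The gap `y = 2 ^ k - 1 - q` is positive, and modulo `2 ^ k` exactly the cells on the
antidiagonals `y + q` and `y + 2 * q` split uniquely. -/
structure UniqueSplitAntidiagonals (k y q : ℕ) : Prop where
  pos : 0 < y
  add_eq : y + q + 1 = 2 ^ k
  splitCount_eq_one_iff : ∀ x z, x < 2 ^ k → z < 2 ^ k →
    (splitCount y x z = 1 ↔ x + z = y + q ∨ x + z = y + q + q)

namespace UniqueSplitAntidiagonals

variable {k y q : ℕ}

theorem properSplitCount_of_le_max (h : UniqueSplitAntidiagonals k y q) {x z : ℕ}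
    (hxz : 2 ^ k ≤ max x z) :
    properSplitCount y x z = splitCount y (x % 2 ^ k) (z % 2 ^ k) := by
  have := h.add_eq
  rw [splitCount_mod_two_pow (by omega), properSplitCount_of_add_ne (by omega)]

theorem not_isUlam_of_mod_eq_zero (h : UniqueSplitAntidiagonals k y q) {x z : ℕ}
    (hxz : 2 ^ k ≤ max x z) (hx : x % 2 ^ k = 0) (hz : z % 2 ^ k + 1 ≠ 2 ^ k) :
    ¬ IsUlam (wordThree x y z) := by
  have h0 := h.pos
  have h1 := h.add_eq
  have h2 : z % 2 ^ k < 2 ^ k := Nat.mod_lt _ (by positivity)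
  apply not_isUlam_wordThree_of_two_le
  rw [h.properSplitCount_of_le_max hxz, hx]
  have h3 := h.splitCount_eq_one_iff 0 (z % 2 ^ k) (by omega) h2
  have h4 : 0 < splitCount y 0 (z % 2 ^ k) := splitCount_pos le_rfl (by simp) (by simp)
  omega

theorem not_isUlam_corner (h : UniqueSplitAntidiagonals k y q) {x : ℕ} (hx : x + 1 = 2 ^ k) :
    ¬ IsUlam (wordThree x y x) := by
  have h0 := h.pos
  have h1 := h.add_eq
  apply not_isUlam_wordThree_diag
  rw [properSplitCount_of_add_ne (by omega)]
  have := h.splitCount_eq_one_iff x x (by omega) (by omega)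
  omega

/-- The closed form of the Ulam words outside the bottom-left block. -/
theorem isUlam_iff (h : UniqueSplitAntidiagonals k y q) {x z : ℕ} (hxz : 2 ^ k ≤ max x z) :
    IsUlam (wordThree x y z) ↔
      (x % 2 ^ k + z % 2 ^ k = y + q ∨ x % 2 ^ k + z % 2 ^ k = y + q + q) ∧
        ¬ (x % 2 ^ k + z % 2 ^ k = y + q + 1 ∨ x % 2 ^ k + z % 2 ^ k = y + q + q + 1) := by
  have h0 := h.pos
  have h1 := h.add_eq
  have hk : 0 < 2 ^ k := by positivity
  induction hn : x + z using Nat.strong_induction_on generalizing x z with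
  | _ n ih =>
    have edge : ∀ x z, x + z = n → 2 ^ k ≤ max x z → x % 2 ^ k = 0 →
        (IsUlam (wordThree x y z) ↔
          (x % 2 ^ k + z % 2 ^ k = y + q ∨ x % 2 ^ k + z % 2 ^ k = y + q + q) ∧
            ¬ (x % 2 ^ k + z % 2 ^ k = y + q + 1 ∨
              x % 2 ^ k + z % 2 ^ k = y + q + q + 1)) := by
      intro x z hn hxz hx
      have hz' := Nat.mod_lt z hk
      have hc := h.splitCount_eq_one_iff _ _ (Nat.mod_lt x hk) hz'
      rw [← h.properSplitCount_of_le_max hxz] at hc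
      by_cases hz : z % 2 ^ k + 1 = 2 ^ k
      · have left : ¬ (0 < x ∧ IsUlam (wordThree (x - 1) y z)) := by
          rintro ⟨hx0, hU⟩
          have hx1 := pred_mod_of_mod_eq_zero hk hx0 hx
          by_cases hb : 2 ^ k ≤ max (x - 1) z
          · have := (ih (x - 1 + z) (by omega) hb rfl).1 hU
            omega
          · rw [Nat.mod_eq_of_lt (by omega)] at hx1 hz
            obtain rfl : z = x - 1 := by omega
            exact h.not_isUlam_corner hz hU
        have down : ¬ (0 < z ∧ IsUlam (wordThree x y (z - 1))) := by
          rintro ⟨hz0, hU⟩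
          have hz1 : (z - 1) % 2 ^ k = z % 2 ^ k - 1 := pred_mod_of_mod_ne_zero (by omega)
          refine h.not_isUlam_of_mod_eq_zero ?_ hx (by omega) hU
          have := le_pred_of_mod_ne_zero (x := z) (n := 2 ^ k) (by omega)
          omega
        rw [isUlam_wordThree_iff, if_neg left, if_neg down]
        omega
      · have := h.not_isUlam_of_mod_eq_zero hxz hx hz
        simp only [this, false_iff]
        omega
    by_cases hx : x % 2 ^ k = 0
    · exact edge x z hn hxz hx
    by_cases hz : z % 2 ^ k = 0
    · rw [isUlam_wordThree_symm, edge z x (by omega) (by omega) hz,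
        add_comm (z % 2 ^ k)]
    have hx0 : 0 < x := Nat.pos_of_ne_zero (by rintro rfl; simp at hx)
    have hz0 : 0 < z := Nat.pos_of_ne_zero (by rintro rfl; simp at hz)
    have hc := h.splitCount_eq_one_iff _ _ (Nat.mod_lt x hk) (Nat.mod_lt z hk)
    rw [← h.properSplitCount_of_le_max hxz] at hc
    have left := ih (x - 1 + z) (by omega) (by
      have := le_pred_of_mod_ne_zero (x := x) (n := 2 ^ k) hx
      omega) rfl
    have down := ih (x + (z - 1)) (by omega) (by
      have := le_pred_of_mod_ne_zero (x := z) (n := 2 ^ k) hz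
      omega) rfl
    rw [pred_mod_of_mod_ne_zero hx] at left
    rw [pred_mod_of_mod_ne_zero hz] at down
    rw [isUlam_wordThree_iff]
    simp only [left, down, hx0, hz0, true_and]
    split_ifs <;> omega

theorem isUlam_wordThree_self_zero_iff (h : UniqueSplitAntidiagonals k y q)
    (hq : splitCount y y 0 = 2 ↔ q ≠ 0) : IsUlam (wordThree y y 0) ↔ q ≠ 0 := by
  have h0 := h.pos
  have h1 := h.add_eq
  have left : ¬ (0 < y ∧ IsUlam (wordThree (y - 1) y 0)) := by
    rintro ⟨-, hU⟩
    refine not_isUlam_wordThree_of_two_le ?_ hU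
    rw [properSplitCount_of_add_ne (by omega)]
    have h2 := h.splitCount_eq_one_iff (y - 1) 0 (by omega) (by omega)
    have h3 : 0 < splitCount y (y - 1) 0 := splitCount_pos (Nat.zero_le y) (by simp) (by simp)
    omega
  have h2 := properSplitCount_self_zero y
  rw [isUlam_wordThree_iff, if_neg left, if_neg (by simp), ← hq]
  omega

theorem isUlam_wordThree_add_mul_iff (h : UniqueSplitAntidiagonals k y q) {m : ℕ} (hm : 0 < m) :
    IsUlam (wordThree (y + m * 2 ^ k) y 0) ↔ q = 0 := by
  have h0 := h.pos
  have h1 := h.add_eq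
  have h2 : 2 ^ k ≤ m * 2 ^ k := Nat.le_mul_of_pos_left _ hm
  rw [h.isUlam_iff (by omega), Nat.add_mul_mod_self_right, Nat.mod_eq_of_lt (by omega),
    Nat.zero_mod]
  omega

end UniqueSplitAntidiagonals

theorem IsZumkeller.exists_uniqueSplitAntidiagonals {k y : ℕ} (h1 : 2 ^ k ≤ y)
    (h2 : y < 2 ^ (k + 1)) (hy : IsZumkeller y) :
    ∃ q, UniqueSplitAntidiagonals (k + 1) y q ∧ (splitCount y y 0 = 2 ↔ q ≠ 0) := by
  obtain hf | ⟨j, hj, hf, -⟩ := exists_gap_of_isZumkeller h1 h2 hy.2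
  · refine ⟨0, ⟨hy.1, hf, fun x z hx hz => ?_⟩, ?_⟩
    · rw [splitCount_full_eq_one_iff hf hx hz]
      omega
    · rw [(splitCount_full_eq_one_iff hf h2 (by positivity)).2 rfl]
      simp
  · refine ⟨2 ^ j, ⟨hy.1, hf, fun x z hx hz => ?_⟩, ?_⟩
    · exact splitCount_zumkeller_eq_one_iff hj hf hx hz
    · simp [splitCount_zumkeller_self_zero hj hf]

/-- For Zumkeller `y` with `2^k ≤ y < 2^(k+1)`, `Ulam[y]` is eventually
biperiodic with biperiod `2^(k+1) × 2^(k+1)`, with all aperiodicities in the bottom-left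
block, and it is not (fully) biperiodic with any biperiod `P × P`, `P ≥ 1`. -/
theorem ulamSet_eventually_biperiodic_of_zumkeller (k y : ℕ)
    (h1 : 2 ^ k ≤ y) (h2 : y < 2 ^ (k + 1)) (hzum : IsZumkeller y) :
    (∀ x z : ℕ, 2 ^ (k + 1) ≤ max x z →
      (((x, z) ∈ UlamSet y ↔ (x + 2 ^ (k + 1), z) ∈ UlamSet y) ∧
       ((x, z) ∈ UlamSet y ↔ (x, z + 2 ^ (k + 1)) ∈ UlamSet y))) ∧
    (∀ P : ℕ, 1 ≤ P →
      ¬ (∀ x z : ℕ,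
          ((x + P, z) ∈ UlamSet y ↔ (x, z) ∈ UlamSet y) ∧
          ((x, z + P) ∈ UlamSet y ↔ (x, z) ∈ UlamSet y))) := by
  obtain ⟨q, h, hq⟩ := hzum.exists_uniqueSplitAntidiagonals h1 h2
  refine ⟨fun x z hxz => ?_, fun P hP hper => ?_⟩
  · simp only [UlamSet, Set.mem_ofPred_eq]
    rw [h.isUlam_iff hxz, h.isUlam_iff (x := x + 2 ^ (k + 1)) (by omega),
      h.isUlam_iff (z := z + 2 ^ (k + 1)) (by omega), Nat.add_mod_right, Nat.add_mod_right]
    exact ⟨Iff.rfl, Iff.rfl⟩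
  · simp only [UlamSet, Set.mem_ofPred_eq] at hper
    have hmul : ∀ n, IsUlam (wordThree (y + n * P) y 0) ↔ IsUlam (wordThree y y 0) := by
      intro n
      induction n with
      | zero => simp
      | succ n ih => rw [add_mul, one_mul, ← add_assoc, (hper _ 0).1, ih]
    have := hmul (2 ^ (k + 1))
    rw [mul_comm, h.isUlam_wordThree_add_mul_iff hP, h.isUlam_wordThree_self_zero_iff hq] at this
    tauto
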